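/- arXiv:1006.5193 — 2 statements merged into one kernel-verified Lean document; each statement's English description precedes it below -/
import Mathlib

section
/- Let M be a nonempty compact metrizable space, Γ a countable group acting on M by homeomorphisms such that the action is minimal (every Γ-orbit is dense) and strongly proximal (for every Borel probability measure ν on M and every nonempty open V ⊆ M, sup_{γ∈Γ} (γ_*ν)(V) = 1). Let Γ act ergodically by measure-preserving transformations on a standard Borel probability space (Y,μ). Let V ⊆ Y×M be a measurable set all of whose fibers V_y = {m ∈ M : (y,m) ∈ V} are open in M, and suppose that for every γ ∈ Γ and μ-a.e. y ∈ Y one has V_{γ·y} = γ·V_y. Then either V_y = ∅ for μ-a.e. y ∈ Y, or V_y = M for μ-a.e. y ∈ Y. -/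
open MeasureTheory
open Set Filter Topology

lemma isCompact_setOf_forall_apply_le (k : ℕ → ℕ) : IsCompact {x : ℕ → ℕ | ∀ i, x i ≤ k i} := by
  simpa [Set.pi] using isCompact_univ_pi (fun i => (Set.finite_Iic (k i)).isCompact)

/-- If the compact set `{x | ∀ i, x i ≤ k i}` is contained in an open set `U`, then finitely many of
the constraints already force membership in `U`. -/
lemma exists_truncation_subset_of_isOpen (k : ℕ → ℕ) {U : Set (ℕ → ℕ)} (hU : IsOpen U)
    (hkU : {x : ℕ → ℕ | ∀ i, x i ≤ k i} ⊆ U) :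
    ∃ n, {x : ℕ → ℕ | ∀ i < n, x i ≤ k i} ⊆ U := by
  by_contra! hcon
  have hex : ∀ n, ∃ x : ℕ → ℕ, (∀ i < n, x i ≤ k i) ∧ x ∉ U := fun n => by
    obtain ⟨x, hx, hxU⟩ := Set.not_subset.1 (hcon n)
    exact ⟨x, hx, hxU⟩
  choose x hx hxU using hex
  obtain ⟨y, hy, φ, hφ, hlim⟩ := (isCompact_setOf_forall_apply_le k).tendsto_subseq
    (x := fun n i => min (x n i) (k i)) (fun n i => min_le_right _ _)
  have hlim' : Tendsto (x ∘ φ) atTop (𝓝 y) := by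
    rw [tendsto_pi_nhds] at hlim ⊢
    intro i
    refine (hlim i).congr' ?_
    filter_upwards [eventually_gt_atTop i] with n hn
    exact min_eq_left (hx (φ n) i (hn.trans_le (hφ.id_le n)))
  obtain ⟨n, hn⟩ := (hlim'.eventually (hU.mem_nhds (hkU hy))).exists
  exact hxU _ hn

/-- Analytic sets can be approximated from inside by compact sets, with respect to any outer
regular measure. -/
lemma exists_isCompact_subset_range_le_measure {α : Type*} [TopologicalSpace α]
    [MeasurableSpace α] (μ : Measure α) [μ.OuterRegular] {f : (ℕ → ℕ) → α} (hf : Continuous f)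
    {r : ENNReal} (hr : r < μ (range f)) :
    ∃ K ⊆ range f, IsCompact K ∧ r ≤ μ K := by
  have step : ∀ (n : ℕ) (T : {T : Set (ℕ → ℕ) // r < μ (f '' T)}),
      ∃ j : ℕ, r < μ (f '' (T.1 ∩ {x | x n ≤ j})) := by
    rintro n ⟨T, hT⟩
    have hmono : Monotone fun j : ℕ => f '' (T ∩ {x | x n ≤ j}) := fun i j hij =>
      image_mono (inter_subset_inter_right _ fun x (hx : x n ≤ i) => hx.trans hij)
    have hun : f '' T = ⋃ j : ℕ, f '' (T ∩ {x | x n ≤ j}) := by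
      rw [← image_iUnion, ← inter_iUnion]
      congr 1
      refine (inter_eq_left.2 fun x _ => mem_iUnion.2 ⟨x n, le_refl (x n)⟩).symm
    rw [hun, hmono.measure_iUnion] at hT
    exact lt_iSup_iff.1 hT
  choose j hj using step
  let T : ℕ → {T : Set (ℕ → ℕ) // r < μ (f '' T)} := fun n =>
    Nat.rec ⟨univ, by rwa [image_univ]⟩ (fun n T => ⟨_, hj n T⟩) n
  let k : ℕ → ℕ := fun n => j n (T n)
  have hT : ∀ n, (T n).1 = {x | ∀ i < n, x i ≤ k i} := by
    intro n
    induction n with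
    | zero => simp [T]
    | succ n ih =>
      change (T n).1 ∩ {x | x n ≤ k n} = _
      rw [ih]
      ext x
      exact Nat.forall_lt_succ_right.symm
  refine ⟨f '' {x | ∀ i, x i ≤ k i}, image_subset_range _ _, (isCompact_setOf_forall_apply_le k).image hf, ?_⟩
  by_contra! hlt
  obtain ⟨U, hKU, hUo, hUr⟩ := Set.exists_isOpen_lt_of_lt _ _ hlt
  obtain ⟨n, hn⟩ := exists_truncation_subset_of_isOpen k (hUo.preimage hf) (image_subset_iff.1 hKU)
  have h1 := (T n).2
  rw [hT n] at h1
  exact (h1.trans_le (measure_mono (image_subset_iff.2 hn))).not_gt hUr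

/-- Analytic sets are universally measurable. -/
lemma MeasureTheory.AnalyticSet.nullMeasurableSet {α : Type*} [TopologicalSpace α] [T2Space α]
    [MeasurableSpace α] [OpensMeasurableSpace α] {μ : Measure α} [IsFiniteMeasure μ]
    [μ.OuterRegular] {s : Set α} (hs : AnalyticSet s) : NullMeasurableSet s μ := by
  rw [AnalyticSet] at hs
  rcases hs with rfl | ⟨f, hf, rfl⟩
  · exact MeasurableSet.empty.nullMeasurableSet
  rcases eq_or_ne (μ (range f)) 0 with h0 | h0
  · exact NullMeasurableSet.of_null h0
  obtain ⟨u, -, hu, hulim⟩ := exists_seq_strictMono_tendsto' (pos_iff_ne_zero.2 h0)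
  choose K hKs hKc hK using fun n => exists_isCompact_subset_range_le_measure μ hf (hu n).2
  have hm : MeasurableSet (⋃ n, K n) := .iUnion fun n => (hKc n).isClosed.measurableSet
  have hle : μ (range f) ≤ μ (⋃ n, K n) :=
    le_of_tendsto' hulim fun n => (hK n).trans (measure_mono (subset_iUnion K n))
  exact hm.nullMeasurableSet.congr
    (ae_eq_of_subset_of_measure_ge (iUnion_subset hKs) hle hm.nullMeasurableSet
      (measure_ne_top μ _))

/-- The measurable projection theorem. -/
lemma MeasurableSet.nullMeasurableSet_image {X Y : Type*} [MeasurableSpace X]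
    [StandardBorelSpace X] [MeasurableSpace Y] [StandardBorelSpace Y] {f : X → Y} {s : Set X}
    (hs : MeasurableSet s) (hf : Measurable f) (μ : Measure Y) [IsFiniteMeasure μ] :
    NullMeasurableSet (f '' s) μ := by
  let := upgradeStandardBorel Y
  exact (hs.analyticSet_image hf).nullMeasurableSet

/-- A measurable set with compact fibers in the product of a standard Borel space with the line
admits an almost everywhere measurable section over its projection. -/
lemma exists_aemeasurable_section_real {Y : Type*} [MeasurableSpace Y] [StandardBorelSpace Y]
    (μ : Measure Y) [IsFiniteMeasure μ] {C : Set (Y × ℝ)} (hC : MeasurableSet C)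
    (hCc : ∀ y, IsCompact {t | (y, t) ∈ C}) :
    ∃ s : Y → ℝ, AEMeasurable s μ ∧ ∀ y, {t | (y, t) ∈ C}.Nonempty → (y, s y) ∈ C := by
  have hex : ∀ y, ∃ t : ℝ, ({t | (y, t) ∈ C}.Nonempty → IsLeast {t | (y, t) ∈ C} t) ∧
      (¬ {t | (y, t) ∈ C}.Nonempty → t = 0) := by
    intro y
    by_cases h : {t | (y, t) ∈ C}.Nonempty
    · obtain ⟨t, ht⟩ := (hCc y).exists_isLeast h
      exact ⟨t, fun _ => ht, fun h' => absurd h h'⟩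
    · exact ⟨0, fun h' => absurd h' h, fun _ => rfl⟩
  choose s hs hs0 using hex
  refine ⟨s, ?_, fun y hy => (hs y hy).1⟩
  refine NullMeasurable.aemeasurable ?_
  refine measurable_of_Iic (α := ℝ) (δ := NullMeasurableSpace Y μ) fun t => ?_
  have key : s ⁻¹' Iic t = Prod.fst '' (C ∩ {p | p.2 ≤ t}) ∪
      ((Prod.fst '' C)ᶜ ∩ {_y | (0 : ℝ) ≤ t}) := by
    ext y
    by_cases h : {t | (y, t) ∈ C}.Nonempty
    · have h1 : y ∈ Prod.fst '' C := by
        obtain ⟨t, ht⟩ := h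
        exact ⟨(y, t), ht, rfl⟩
      simp only [mem_preimage, mem_Iic, mem_union, mem_inter_iff, mem_compl_iff, h1,
        not_true_eq_false, false_and, or_false]
      constructor
      · exact fun hst => ⟨(y, s y), ⟨(hs y h).1, hst⟩, rfl⟩
      · rintro ⟨⟨y', t'⟩, ⟨hp, ht'⟩, rfl⟩
        exact ((hs _ h).2 hp).trans ht'
    · have h1 : y ∉ Prod.fst '' C := by
        rintro ⟨⟨y', t'⟩, hp, rfl⟩
        exact h ⟨t', hp⟩
      have h2 : y ∉ Prod.fst '' (C ∩ {p | p.2 ≤ t}) := fun h' =>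
        h1 (image_mono inter_subset_left h')
      simp [h1, h2, hs0 y h, -mem_image]
  suffices NullMeasurableSet (s ⁻¹' Iic t) μ from this
  rw [key]
  exact ((hC.inter (measurable_snd measurableSet_Iic)).nullMeasurableSet_image
    measurable_fst μ).union (((hC.nullMeasurableSet_image measurable_fst μ).compl).inter
      (MeasurableSet.const _).nullMeasurableSet)

/-- A measurable set with closed fibers in the product of a standard Borel space with a compact
metrizable space admits an almost everywhere measurable section over its projection. -/
lemma exists_aemeasurable_section {Y M : Type*} [MeasurableSpace Y] [StandardBorelSpace Y]
    [TopologicalSpace M] [CompactSpace M] [TopologicalSpace.MetrizableSpace M] [Nonempty M]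
    [MeasurableSpace M] [BorelSpace M]
    (μ : Measure Y) [IsFiniteMeasure μ] {C : Set (Y × M)} (hC : MeasurableSet C)
    (hCc : ∀ y, IsClosed {m | (y, m) ∈ C}) :
    ∃ s : Y → M, AEMeasurable s μ ∧ ∀ y, {m | (y, m) ∈ C}.Nonempty → (y, s y) ∈ C := by
  let := TopologicalSpace.metrizableSpaceMetric M
  obtain ⟨f, hf, hfs⟩ := exists_nat_bool_continuous_surjective_of_compact M
  let g : cantorSet → M := f ∘ cantorSetHomeomorphNatToBool
  have hg : Continuous g := hf.comp cantorSetHomeomorphNatToBool.continuous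
  have hgs : Function.Surjective g := hfs.comp cantorSetHomeomorphNatToBool.surjective
  have hcm : MeasurableSet cantorSet := isClosed_cantorSet.measurableSet
  let D : Set (Y × ℝ) := Prod.map id Subtype.val '' (Prod.map id g ⁻¹' C)
  have hD : ∀ y (t : cantorSet), (y, (t : ℝ)) ∈ D ↔ (y, g t) ∈ C := by
    intro y t
    constructor
    · rintro ⟨⟨y', t'⟩, hp, he⟩
      obtain ⟨rfl, ht⟩ := Prod.mk_inj.1 he
      obtain rfl : t' = t := Subtype.ext ht
      exact hp
    · exact fun h => ⟨(y, t), h, rfl⟩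
  have hDc : ∀ p ∈ D, p.2 ∈ cantorSet := by
    rintro _ ⟨p, -, rfl⟩
    exact p.2.2
  have hDm : MeasurableSet D :=
    (MeasurableEmbedding.id.prodMap (MeasurableEmbedding.subtype_coe hcm)).measurableSet_image.2
      ((measurable_id.prodMap hg.measurable) hC)
  have hDcomp : ∀ y, IsCompact {t | (y, t) ∈ D} := by
    intro y
    have : CompactSpace cantorSet := isCompact_iff_compactSpace.1 isCompact_cantorSet
    have : {t | (y, t) ∈ D} = Subtype.val '' (g ⁻¹' {m | (y, m) ∈ C}) := by
      ext t
      constructor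
      · intro ht
        exact ⟨⟨t, hDc _ ht⟩, (hD y ⟨t, hDc _ ht⟩).1 ht, rfl⟩
      · rintro ⟨t, ht, rfl⟩
        exact (hD y t).2 ht
    rw [this]
    exact (((hCc y).preimage hg).isCompact).image continuous_subtype_val
  obtain ⟨s, hsm, hs⟩ := exists_aemeasurable_section_real μ hDm hDcomp
  classical
  let h : ℝ → M := fun t => if ht : t ∈ cantorSet then g ⟨t, ht⟩ else Classical.arbitrary M
  have hh : Measurable h := Measurable.dite (s := cantorSet) (f := g)
    hg.measurable measurable_const hcm
  refine ⟨h ∘ s, hh.comp_aemeasurable hsm, ?_⟩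
  rintro y ⟨m, hm⟩
  obtain ⟨t, rfl⟩ := hgs m
  have h1 := hs y ⟨t, (hD y t).2 hm⟩
  have h2 : s y ∈ cantorSet := hDc _ h1
  have h3 : (h ∘ s) y = g ⟨s y, h2⟩ := dif_pos h2
  rw [h3]
  exact (hD y ⟨s y, h2⟩).1 h1

/-- For an ergodic action of a countable group, an almost invariant null measurable set is null or
conull. -/
lemma ae_or_ae_not_of_ergodic {Γ Y : Type*} [Group Γ] [Countable Γ] [MeasurableSpace Y]
    {μ : Measure Y} [IsProbabilityMeasure μ] {b : Γ → Y → Y}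
    (hb_mul : ∀ γ γ' y, b (γ * γ') y = b γ (b γ' y))
    (hb_mp : ∀ γ, MeasurePreserving (b γ) μ μ)
    (herg : ∀ s : Set Y, MeasurableSet s → (∀ γ : Γ, b γ ⁻¹' s = s) → μ s = 0 ∨ μ s = 1)
    {F : Set Y} (hF : NullMeasurableSet F μ) (hinv : ∀ γ, b γ ⁻¹' F =ᵐ[μ] F) :
    (∀ᵐ y ∂μ, y ∈ F) ∨ ∀ᵐ y ∂μ, y ∉ F := by
  obtain ⟨t, ht, htF⟩ := hF
  have hinter : (⋂ γ, b γ ⁻¹' t) =ᵐ[μ] F := by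
    have h1 : ∀ᵐ y ∂μ, ∀ γ, (y ∈ b γ ⁻¹' t ↔ y ∈ F) := ae_all_iff.2 fun γ =>
      (((hb_mp γ).quasiMeasurePreserving.preimage_ae_eq htF.symm).trans (hinv γ)).mem_iff
    refine eventuallyEq_set.2 ?_
    filter_upwards [h1] with y hy
    simp only [mem_iInter, hy, forall_const]
  have hmeas : MeasurableSet (⋂ γ, b γ ⁻¹' t) := .iInter fun γ => (hb_mp γ).measurable ht
  have hstrict : ∀ γ, b γ ⁻¹' (⋂ γ, b γ ⁻¹' t) = ⋂ γ, b γ ⁻¹' t := by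
    intro γ
    ext y
    simp only [mem_preimage, mem_iInter, ← hb_mul]
    exact ⟨fun h δ => by simpa using h (δ * γ⁻¹), fun h δ => h (δ * γ)⟩
  rcases herg _ hmeas hstrict with h0 | h1
  · right
    filter_upwards [measure_eq_zero_iff_ae_notMem.1 h0, hinter.mem_iff] with y hy hy'
    rwa [← hy']
  · left
    filter_upwards [(prob_compl_eq_zero_iff hmeas).2 h1, hinter.mem_iff] with y hy hy'
    rwa [← hy']

/-- **Furstenberg's lemma, equivariant-family form.** Let a countable
group `Γ` act minimally and strongly proximally by homeomorphisms on a nonempty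
compact metrizable space `M`, and act ergodically by measure-preserving
transformations on a standard Borel probability space `(Y,μ)`. If `V ⊆ Y × M` is a
measurable set with open fibers `V_y` satisfying `V_{γ·y} = γ·V_y` (a.e., for each
`γ`), then a.e. `V_y = ∅` or a.e. `V_y = M`. -/
theorem stmt_14
    (M : Type) [TopologicalSpace M] [CompactSpace M] [TopologicalSpace.MetrizableSpace M]
    [Nonempty M] [MeasurableSpace M] [BorelSpace M]
    (Γ : Type) [Group Γ] [Countable Γ]
    (a : Γ → M → M)
    (ha_one : ∀ x, a 1 x = x)
    (ha_mul : ∀ γ γ' x, a (γ * γ') x = a γ (a γ' x))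
    (ha_cont : ∀ γ, Continuous (a γ))
    (hmin : ∀ x : M, Dense {y : M | ∃ γ : Γ, a γ x = y})
    (hprox : ∀ ν : Measure M, IsProbabilityMeasure ν →
      ∀ W : Set M, IsOpen W → W.Nonempty → (⨆ γ : Γ, Measure.map (a γ) ν W) = 1)
    (Y : Type) [MeasurableSpace Y] [StandardBorelSpace Y]
    (μ : Measure Y) [IsProbabilityMeasure μ]
    (b : Γ → Y → Y)
    (hb_one : ∀ y, b 1 y = y)
    (hb_mul : ∀ γ γ' y, b (γ * γ') y = b γ (b γ' y))
    (hb_meas : ∀ γ, Measurable (b γ))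
    (hb_mp : ∀ γ, MeasurePreserving (b γ) μ μ)
    (herg : ∀ s : Set Y, MeasurableSet s → (∀ γ : Γ, b γ ⁻¹' s = s) →
      μ s = 0 ∨ μ s = 1)
    (V : Set (Y × M)) (hV_meas : MeasurableSet V)
    (hV_open : ∀ y : Y, IsOpen {x : M | (y, x) ∈ V})
    (hV_equiv : ∀ γ : Γ, ∀ᵐ y ∂μ,
      {x : M | (b γ y, x) ∈ V} = (a γ) '' {x : M | (y, x) ∈ V}) :
    (∀ᵐ y ∂μ, {x : M | (y, x) ∈ V} = ∅) ∨
      (∀ᵐ y ∂μ, {x : M | (y, x) ∈ V} = Set.univ) := by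
  have : PolishSpace M := by
    let := TopologicalSpace.metrizableSpaceMetric M
    infer_instance
  have hproj : ∀ W : Set M, MeasurableSet W →
      NullMeasurableSet {y | ∃ m ∈ W, (y, m) ∉ V} μ := by
    intro W hW
    have h := ((hV_meas.compl.inter (measurable_snd hW)).nullMeasurableSet_image
      measurable_fst μ)
    convert h using 1
    ext y
    simp [and_comm]
  have himage : ∀ γ (S : Set M) m, a γ m ∈ a γ '' S ↔ m ∈ S := fun γ S m =>
    Function.Injective.mem_set_image fun x x' hxx' => by
      rw [← ha_one x, ← ha_one x', ← inv_mul_cancel γ, ha_mul, ha_mul, hxx']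
  have hmem : ∀ γ, ∀ᵐ y ∂μ, ∀ m, (b γ y, a γ m) ∈ V ↔ (y, m) ∈ V := by
    intro γ
    filter_upwards [hV_equiv γ] with y hy m
    exact (Set.ext_iff.1 hy (a γ m)).trans (himage γ {x | (y, x) ∈ V} m)
  have hinv : ∀ γ, b γ ⁻¹' {y | ∃ m, (y, m) ∉ V} =ᵐ[μ] {y | ∃ m, (y, m) ∉ V} := by
    intro γ
    refine eventuallyEq_set.2 ?_
    filter_upwards [hmem γ] with y hy
    constructor
    · rintro ⟨m, hm⟩
      refine ⟨a γ⁻¹ m, fun h => hm ?_⟩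
      rwa [← hy, ← ha_mul, mul_inv_cancel, ha_one] at h
    · rintro ⟨m, hm⟩
      exact ⟨a γ m, fun h => hm ((hy m).1 h)⟩
  have hF : NullMeasurableSet {y | ∃ m, (y, m) ∉ V} μ := by
    simpa using hproj univ MeasurableSet.univ
  rcases ae_or_ae_not_of_ergodic hb_mul hb_mp herg hF hinv with hne | hem
  swap
  · right
    filter_upwards [hem] with y hy
    simpa [Set.eq_univ_iff_forall] using hy
  left
  obtain ⟨s, hsm, hs⟩ := exists_aemeasurable_section μ hV_meas.compl
    fun y => (hV_open y).isClosed_compl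
  have hsV : ∀ᵐ y ∂μ, (y, s y) ∉ V := by
    filter_upwards [hne] with y hy
    exact hs y hy
  have : IsProbabilityMeasure (μ.map s) := Measure.isProbabilityMeasure_map hsm
  have hfull : ∀ W : Set M, IsOpen W → W.Nonempty → ∀ᵐ y ∂μ, ∃ m ∈ W, (y, m) ∉ V := by
    intro W hW hWn
    have hle : 1 ≤ μ {y | ∃ m ∈ W, (y, m) ∉ V} := by
      rw [← hprox (μ.map s) inferInstance W hW hWn]
      refine iSup_le fun γ => ?_
      have hγ := (ha_cont γ).measurable
      rw [Measure.map_apply hγ hW.measurableSet,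
        Measure.map_apply_of_aemeasurable hsm (hγ hW.measurableSet),
        ← (hb_mp γ).measure_preimage (hproj W hW.measurableSet)]
      refine measure_mono_ae ?_
      filter_upwards [hsV, hmem γ] with y hy hyγ hyW
      exact ⟨a γ (s y), hyW, fun h => hy ((hyγ _).1 h)⟩
    exact mem_ae_iff_prob_eq_one₀ (hproj W hW.measurableSet) |>.2 (le_antisymm prob_le_one hle)
  have hall : ∀ᵐ y ∂μ, ∀ W ∈ TopologicalSpace.countableBasis M, ∃ m ∈ W, (y, m) ∉ V :=
    (ae_ball_iff (TopologicalSpace.countable_countableBasis M)).2 fun W hW =>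
      hfull W (TopologicalSpace.isOpen_of_mem_countableBasis hW)
        (TopologicalSpace.nonempty_of_mem_countableBasis hW)
  filter_upwards [hall] with y hy
  by_contra hcon
  obtain ⟨x, hx⟩ := Set.nonempty_iff_ne_empty.2 hcon
  obtain ⟨W, hW, -, hWV⟩ :=
    (TopologicalSpace.isBasis_countableBasis M).exists_subset_of_mem_open hx (hV_open y)
  obtain ⟨m, hmW, hmV⟩ := hy W hW
  exact hmV (hWV hmW)
end

section
/- For every natural number n ≥ 4 and every real number θ with cos θ = −1/(n−1), the ratio θ/π is irrational (θ is not a rational multiple of π). Equivalently, for n ≥ 4, no complex root w of the polynomial (n−1)z² + 2z + (n−1) is a root of unity. -/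
/-- For every `n ≥ 4`, any real `θ` with `cos θ = −1/(n−1)` is an
irrational multiple of `π` (the dihedral angle of a regular Euclidean `(n−1)`-simplex
is not a rational multiple of `π`); equivalently, no complex root of
`(n−1)z² + 2z + (n−1)` is a root of unity. -/
theorem stmt_16 (n : ℕ) (hn : 4 ≤ n) :
    (∀ θ : ℝ, Real.cos θ = -1 / ((n : ℝ) - 1) → Irrational (θ / Real.pi)) ∧
    (∀ w : ℂ, ((n : ℂ) - 1) * w ^ 2 + 2 * w + ((n : ℂ) - 1) = 0 →
      ∀ m : ℕ, 0 < m → w ^ m ≠ 1) := by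
  refine ⟨fun θ hθ hrat ↦ ?_, fun w hw m hm hwm ↦ ?_⟩
  · obtain ⟨q, hq⟩ := hrat
    have hmem := niven (θ := θ) ⟨q, by rw [hq, div_mul_cancel₀ _ Real.pi_ne_zero]⟩
      ⟨-1 / ((n : ℚ) - 1), by rw [hθ]; push_cast; rfl⟩
    have hn' : (4 : ℝ) ≤ n := by exact_mod_cast hn
    have hpos : (0 : ℝ) < n - 1 := by linarith
    have hlt : Real.cos θ < 0 := by
      rw [hθ]
      exact div_neg_of_neg_of_pos (by norm_num) hpos
    have hgt : -1 / 2 < Real.cos θ := by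
      rw [hθ, div_lt_div_iff₀ two_pos hpos]
      linarith
    simp only [Set.mem_insert_iff, Set.mem_singleton_iff] at hmem
    rcases hmem with h | h | h | h | h <;> linarith
  · have hw0 : w ≠ 0 := by
      rintro rfl
      simp [hm.ne'] at hwm
    have hn1 : (n : ℂ) - 1 ≠ 0 := by
      rw [sub_ne_zero]
      exact_mod_cast (by omega : n ≠ 1)
    have hint : IsIntegral ℤ (w + w⁻¹) := by
      refine .add (.of_pow hm (hwm ▸ isIntegral_one)) (.of_pow hm ?_)
      rw [inv_pow, hwm, inv_one]
      exact isIntegral_one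
    have hsum : ((n : ℂ) - 1) * (w + w⁻¹) = -2 := by
      field_simp
      linear_combination hw
    obtain ⟨k, hk⟩ := hint.exists_int_iff_exists_rat.mp
      ⟨-2 / ((n : ℚ) - 1), by push_cast; rw [eq_div_iff hn1, mul_comm, hsum]⟩
    rw [hk] at hsum
    have hdvd : ((n : ℤ) - 1) * k = -2 := by exact_mod_cast hsum
    have hle : (n : ℤ) - 1 ≤ 2 := Int.le_of_dvd two_pos ⟨-k, by linarith⟩
    omega
end
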